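/- Let τ lie in the complex upper half-plane. Then (σ²·v(τ)² − 1)·v(−1/(8τ))² = v(τ)² − σ², where σ = −1 + √2; that is, v(−1/(8τ))² = (v(τ)² − σ²)/(σ²·v(τ)² − 1) whenever the denominator is nonzero. -/

import Mathlib

/-- `qpow τ r = exp(2πi·r·τ)`, i.e. `q^r` where `q = exp(2πiτ)`. -/
noncomputable def qpow (τ : ℂ) (r : ℝ) : ℂ :=
  Complex.exp (2 * (Real.pi : ℂ) * Complex.I * (r : ℂ) * τ)

/-- The Kronecker symbol `(2/n)`: `+1` if `n ≡ ±1 (mod 8)`, `-1` if `n ≡ ±3 (mod 8)`,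
`0` if `n` is even. -/
def chi8 (n : ℕ) : ℤ :=
  if n % 8 = 1 ∨ n % 8 = 7 then 1 else if n % 8 = 3 ∨ n % 8 = 5 then -1 else 0

/-- Ramanujan's continued fraction value
`v(τ) = q^{1/2} ∏_{n≥1} (1 - q^n)^{χ₈(n)}`, `q = exp(2πiτ)`. -/
noncomputable def vRam (τ : ℂ) : ℂ :=
  qpow τ (1/2) * ∏' n : ℕ, (1 - qpow τ ((n : ℝ) + 1)) ^ chi8 (n + 1)

open Filter Topology

/-- The theta series `∑_{n ∈ ℤ} xⁿ q^{n²}`. -/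
noncomputable def thetaSeries (x q : ℂ) : ℂ := ∑' n : ℤ, x ^ n * q ^ (n ^ 2)

lemma exp_mul_thetaSeries_term (z τ : ℂ) (n : ℤ) :
    Complex.exp (2 * Real.pi * Complex.I * z) ^ n * Complex.exp (Real.pi * Complex.I * τ) ^ (n ^ 2)
      = jacobiTheta₂_term n z τ := by
  rw [← Complex.exp_int_mul, ← Complex.exp_int_mul, ← Complex.exp_add, jacobiTheta₂_term]
  congr 1
  push_cast
  ring

lemma summable_thetaSeries {x q : ℂ} (hx : x ≠ 0) (hq : q ≠ 0) (hq1 : ‖q‖ < 1) :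
    Summable fun n : ℤ => x ^ n * q ^ (n ^ 2) := by
  have hpi : (Real.pi : ℂ) ≠ 0 := by exact_mod_cast Real.pi_ne_zero
  have h1 : x = Complex.exp (2 * Real.pi * Complex.I
      * (Complex.log x / (2 * Real.pi * Complex.I))) := by
    rw [mul_div_cancel₀ _ (by simp [hpi]), Complex.exp_log hx]
  have h2 : q = Complex.exp (Real.pi * Complex.I
      * (Complex.log q / (Real.pi * Complex.I))) := by
    rw [mul_div_cancel₀ _ (by simp [hpi]), Complex.exp_log hq]
  rw [h1, h2]
  simp_rw [exp_mul_thetaSeries_term]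
  rw [summable_jacobiTheta₂_term_iff]
  have h3 : Complex.log q / (Real.pi * Complex.I)
      = ((Real.pi⁻¹ : ℝ) : ℂ) * (-(Complex.I * Complex.log q)) := by
    push_cast
    field_simp
    rw [Complex.I_sq]
    ring
  rw [h3, Complex.im_ofReal_mul]
  have := Real.log_neg (norm_pos_iff.2 hq) hq1
  have h4 : (-(Complex.I * Complex.log q)).im = -Real.log ‖q‖ := by
    simp [Complex.log_re]
  rw [h4]
  have := Real.pi_pos
  exact mul_pos (inv_pos.2 this) (by linarith)

lemma thetaSeries_inv (x q : ℂ) : thetaSeries x⁻¹ q = thetaSeries x q := by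
  unfold thetaSeries
  rw [← (Equiv.neg ℤ).tsum_eq]
  refine tsum_congr fun n => ?_
  simp

lemma thetaSeries_mul_sq {x q : ℂ} (hx : x ≠ 0) (hq : q ≠ 0) :
    x * q * thetaSeries (x * q ^ 2) q = thetaSeries x q := by
  unfold thetaSeries
  rw [← tsum_mul_left, ← (Equiv.addRight (1 : ℤ)).tsum_eq (fun n : ℤ => x ^ n * q ^ (n ^ 2))]
  refine tsum_congr fun n => ?_
  simp only [Equiv.coe_addRight]
  rw [show (n + 1) ^ 2 = n ^ 2 + 2 * n + 1 by ring, zpow_add₀ hx, zpow_add₀ hq, zpow_add₀ hq,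
    zpow_mul, mul_zpow]
  norm_cast
  ring

/-- Splitting a sum over `ℤ` into even and odd terms. -/
lemma tsum_int_even_add_odd {f : ℤ → ℂ} (hf : Summable f) :
    ∑' n, f n = ∑' n, f (2 * n) + ∑' n, f (2 * n + 1) := by
  have hbij : Function.Bijective
      (Sum.elim (fun n : ℤ => 2 * n) (fun n : ℤ => 2 * n + 1)) := by
    constructor
    · rintro (a | a) (b | b) h <;> simp at h ⊢ <;> omega
    · intro n
      rcases Int.even_or_odd' n with ⟨k, hk | hk⟩
      · exact ⟨.inl k, hk.symm⟩
      · exact ⟨.inr k, hk.symm⟩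
  have hs := (Equiv.ofBijective _ hbij).summable_iff.2 hf
  rw [← (Equiv.ofBijective _ hbij).tsum_eq f]
  exact Summable.tsum_sum (hs.comp_injective Sum.inl_injective)
    (hs.comp_injective Sum.inr_injective)

/-- Splitting a sum over `ℤ × ℤ` along the sum and difference of the two coordinates. -/
lemma tsum_int_prod_parity {f : ℤ × ℤ → ℂ} (hf : Summable f) :
    ∑' p, f p = ∑' p : ℤ × ℤ, f (p.1 + p.2, p.1 - p.2)
      + ∑' p : ℤ × ℤ, f (p.1 + p.2 + 1, p.1 - p.2) := by
  have hbij : Function.Bijective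
      (Sum.elim (fun p : ℤ × ℤ => (p.1 + p.2, p.1 - p.2))
        (fun p : ℤ × ℤ => (p.1 + p.2 + 1, p.1 - p.2))) := by
    constructor
    · rintro (⟨a, b⟩ | ⟨a, b⟩) (⟨c, d⟩ | ⟨c, d⟩) h <;> simp at h ⊢ <;> omega
    · rintro ⟨m, n⟩
      rcases Int.even_or_odd' (m + n) with ⟨k, hk | hk⟩
      · exact ⟨.inl (k, m - k), by ext <;> simp; omega⟩
      · exact ⟨.inr (k, m - k - 1), by ext <;> (simp; omega)⟩
  have hs := (Equiv.ofBijective _ hbij).summable_iff.2 hf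
  rw [← (Equiv.ofBijective _ hbij).tsum_eq f]
  exact Summable.tsum_sum (hs.comp_injective Sum.inl_injective)
    (hs.comp_injective Sum.inr_injective)

lemma thetaSeries_dissection {x q : ℂ} (hx : x ≠ 0) (hq : q ≠ 0) (hq1 : ‖q‖ < 1) :
    thetaSeries x q = thetaSeries (x ^ 2) (q ^ 4)
      + x * q * thetaSeries (x ^ 2 * q ^ 4) (q ^ 4) := by
  unfold thetaSeries
  rw [tsum_int_even_add_odd (summable_thetaSeries hx hq hq1), ← tsum_mul_left]
  congr 1
  · refine tsum_congr fun n => ?_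
    rw [zpow_mul, show (2 * n) ^ 2 = 4 * n ^ 2 by ring, zpow_mul]
    norm_cast
  · refine tsum_congr fun n => ?_
    rw [show (2 * n + 1) ^ 2 = 4 * n ^ 2 + 4 * n + 1 by ring, zpow_add₀ hq, zpow_add₀ hq,
      zpow_add₀ hx, zpow_mul, zpow_mul, zpow_mul, mul_zpow]
    norm_cast
    ring

lemma norm_pow_lt_one {q : ℂ} (hq1 : ‖q‖ < 1) {k : ℕ} (hk : k ≠ 0) : ‖q ^ k‖ < 1 := by
  rw [norm_pow]
  exact pow_lt_one₀ (norm_nonneg _) hq1 hk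

lemma thetaSeries_sq {x q : ℂ} (hx : x ≠ 0) (hq : q ≠ 0) (hq1 : ‖q‖ < 1) :
    thetaSeries x q ^ 2 = thetaSeries (x ^ 2) (q ^ 2) * thetaSeries 1 (q ^ 2)
      + x * q * (thetaSeries (x ^ 2 * q ^ 2) (q ^ 2) * thetaSeries (q ^ 2) (q ^ 2)) := by
  have hs : ∀ {y r : ℂ}, y ≠ 0 → r ≠ 0 → ‖r‖ < 1 →
      Summable fun n : ℤ => ‖y ^ n * r ^ (n ^ 2)‖ := fun h1 h2 h3 =>
    (summable_thetaSeries h1 h2 h3).norm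
  have hq2 : q ^ 2 ≠ 0 := pow_ne_zero _ hq
  have hx2 : x ^ 2 ≠ 0 := pow_ne_zero _ hx
  have hq21 := norm_pow_lt_one hq1 two_ne_zero
  have h0 := hs hx hq hq1
  unfold thetaSeries
  rw [sq (∑' n : ℤ, x ^ n * q ^ (n ^ 2)), tsum_mul_tsum_of_summable_norm h0 h0,
    tsum_mul_tsum_of_summable_norm (hs hx2 hq2 hq21) (hs one_ne_zero hq2 hq21),
    tsum_mul_tsum_of_summable_norm (hs (mul_ne_zero hx2 hq2) hq2 hq21) (hs hq2 hq2 hq21),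
    tsum_int_prod_parity (summable_mul_of_summable_norm h0 h0), ← tsum_mul_left]
  have hpow (y : ℂ) (n : ℤ) : (y ^ 2) ^ n = y ^ (2 * n) := by
    rw [zpow_mul]
    norm_cast
  congr 1
  · refine tsum_congr fun p => ?_
    simp only [hpow, one_zpow, one_mul]
    rw [mul_mul_mul_comm, ← zpow_add₀ hx, ← zpow_add₀ hq, mul_assoc, ← zpow_add₀ hq]
    congr 2 <;> ring
  · refine tsum_congr fun p => ?_
    simp only [hpow, mul_zpow]
    trans x ^ (2 * p.1 + 1) * q ^ ((2 * p.1 + 2 * p.1 ^ 2) + (2 * p.2 + 2 * p.2 ^ 2) + 1)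
    · rw [mul_mul_mul_comm, ← zpow_add₀ hx, ← zpow_add₀ hq]
      congr 2 <;> ring
    · rw [zpow_add₀ hx, zpow_add₀ hq, zpow_add₀ hq, zpow_add₀ hq, zpow_add₀ hq, zpow_one, zpow_one]
      ring

lemma exists_tendsto_prod_one_add {u : ℕ → ℂ} (hu : Summable fun n => ‖u n‖)
    (h : ∀ n, 1 + u n ≠ 0) :
    ∃ L ≠ 0, Tendsto (fun N => ∏ n ∈ Finset.range N, (1 + u n)) atTop (𝓝 L) :=
  ⟨_, tprod_one_add_ne_zero_of_summable h hu,
    (multipliable_one_add_of_summable hu).hasProd.tendsto_prod_nat⟩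

lemma summable_norm_mul_pow (c : ℂ) {q : ℂ} (hq1 : ‖q‖ < 1) {a : ℕ} (ha : a ≠ 0) (b : ℕ) :
    Summable fun n : ℕ => ‖c * q ^ (a * n + b)‖ := by
  have h := (summable_geometric_of_norm_lt_one (norm_pow_lt_one hq1 ha)).norm.mul_left ‖c * q ^ b‖
  refine h.congr fun n => ?_
  rw [← norm_mul, pow_add, pow_mul]
  congr 1
  ring

lemma one_sub_pow_ne_zero {q : ℂ} (hq1 : ‖q‖ < 1) {k : ℕ} (hk : k ≠ 0) : 1 - q ^ k ≠ 0 := by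
  intro h
  have h1 := norm_pow_lt_one hq1 hk
  rw [← sub_eq_zero.1 h, norm_one] at h1
  exact lt_irrefl _ h1

/-- The `q`-Pochhammer symbol `(q; q)ₙ`. -/
noncomputable def qPoch (q : ℂ) (n : ℕ) : ℂ := ∏ k ∈ Finset.range n, (1 - q ^ (k + 1))

/-- The reciprocal of `(q; q)ₙ`, extended by zero to negative `n`. -/
noncomputable def qPochInv (q : ℂ) (n : ℤ) : ℂ := if 0 ≤ n then (qPoch q n.toNat)⁻¹ else 0

lemma qPoch_succ (q : ℂ) (n : ℕ) : qPoch q (n + 1) = qPoch q n * (1 - q ^ (n + 1)) :=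
  Finset.prod_range_succ _ _

lemma exists_tendsto_qPoch {q : ℂ} (hq1 : ‖q‖ < 1) :
    ∃ L ≠ 0, Tendsto (qPoch q) atTop (𝓝 L) := by
  obtain ⟨L, hL, h⟩ := exists_tendsto_prod_one_add (u := fun n => -1 * q ^ (1 * n + 1))
    (summable_norm_mul_pow _ hq1 one_ne_zero 1) fun n => by
      simpa [sub_eq_add_neg] using one_sub_pow_ne_zero hq1 n.succ_ne_zero
  refine ⟨L, hL, h.congr fun N => Finset.prod_congr rfl fun n _ => ?_⟩
  ring

lemma qPochInv_sub_one {q : ℂ} (hq1 : ‖q‖ < 1) (n : ℤ) :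
    qPochInv q (n - 1) = (1 - q ^ n) * qPochInv q n := by
  rcases lt_trichotomy n 0 with h | rfl | h
  · rw [qPochInv, qPochInv, if_neg (by omega), if_neg (by omega), mul_zero]
  · simp [qPochInv]
  · obtain ⟨k, rfl⟩ : ∃ k : ℕ, n = k + 1 := ⟨(n - 1).toNat, by omega⟩
    have hne := one_sub_pow_ne_zero hq1 k.succ_ne_zero
    have h1 : ((k : ℤ) + 1).toNat = k + 1 := by omega
    rw [qPochInv, qPochInv, if_pos (by omega), if_pos (by omega), h1, qPoch_succ, mul_inv,
      add_sub_cancel_right, Int.toNat_natCast, ← Nat.cast_add_one, zpow_natCast]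
    field_simp

/-- The coefficients of the finite form of the Jacobi triple product. -/
noncomputable def tripleCoeff (q : ℂ) (N : ℕ) (j : ℤ) : ℂ :=
  qPoch q (2 * N) * (qPochInv q (N + j) * qPochInv q (N - j))

lemma tripleCoeff_zero (q : ℂ) (j : ℤ) : tripleCoeff q 0 j = if j = 0 then 1 else 0 := by
  rcases lt_trichotomy j 0 with h | rfl | h
  · simp [tripleCoeff, qPochInv, h.ne, h]
  · simp [tripleCoeff, qPochInv, qPoch]
  · simp [tripleCoeff, qPochInv, h.ne', h]

lemma tripleCoeff_succ {q : ℂ} (hq : q ≠ 0) (hq1 : ‖q‖ < 1) (N : ℕ) (j : ℤ) :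
    tripleCoeff q (N + 1) j = (1 + q ^ (2 * N + 1)) * tripleCoeff q N j
      + q ^ (N + 1 - j) * tripleCoeff q N (j - 1) + q ^ (N + 1 + j) * tripleCoeff q N (j + 1) := by
  unfold tripleCoeff
  have h1 := qPochInv_sub_one hq1 (N + 1 + j)
  have h2 := qPochInv_sub_one hq1 (N + j)
  have h3 := qPochInv_sub_one hq1 (N + 1 - j)
  have h4 := qPochInv_sub_one hq1 (N - j)
  rw [show (N : ℤ) + 1 + j - 1 = N + j by ring] at h1
  rw [show (N : ℤ) + 1 - j - 1 = N - j by ring] at h3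
  rw [show (N : ℤ) + (j - 1) = N + j - 1 by ring, show (N : ℤ) - (j - 1) = N + 1 - j by ring,
    show (N : ℤ) + (j + 1) = N + 1 + j by ring, show (N : ℤ) - (j + 1) = N - j - 1 by ring,
    h2, h4, h1, h3, show 2 * (N + 1) = 2 * N + 1 + 1 by ring, qPoch_succ, qPoch_succ]
  push_cast
  rw [show (N : ℤ) + 1 + j = (N + j) + 1 by ring, show (N : ℤ) + 1 - j = (N - j) + 1 by ring,
    zpow_add_one₀ hq, zpow_add_one₀ hq]
  have h5 : q ^ (2 * N) = q ^ ((N : ℤ) + j) * q ^ ((N : ℤ) - j) := by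
    rw [← zpow_add₀ hq, ← zpow_natCast]
    congr 1
    push_cast
    ring
  rw [pow_succ q (2 * N + 1), pow_succ q (2 * N), h5]
  ring

/-- The finite form of the Jacobi triple product. -/
lemma hasSum_tripleCoeff {x q : ℂ} (hx : x ≠ 0) (hq : q ≠ 0) (hq1 : ‖q‖ < 1) (N : ℕ) :
    HasSum (fun j : ℤ => tripleCoeff (q ^ 2) N j * (x ^ j * q ^ (j ^ 2)))
      (∏ n ∈ Finset.range N, ((1 + x * q ^ (2 * n + 1)) * (1 + x⁻¹ * q ^ (2 * n + 1)))) := by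
  induction N with
  | zero =>
    convert! hasSum_ite_eq (0 : ℤ) (1 : ℂ) using 2 with j
    rw [tripleCoeff_zero]
    split_ifs with h <;> simp [h]
  | succ N ih =>
    have h1 := ((Equiv.subRight (1 : ℤ)).hasSum_iff.2 ih).mul_left (x * q ^ (2 * N + 1))
    have h2 := ((Equiv.addRight (1 : ℤ)).hasSum_iff.2 ih).mul_left (x⁻¹ * q ^ (2 * N + 1))
    have h3 := ((ih.mul_left (1 + q ^ (4 * N + 2))).add h1).add h2
    rw [Finset.prod_range_succ]
    convert! h3 using 1
    · funext j
      have hq2 (k : ℤ) : (q ^ 2) ^ k = q ^ (2 * k) := by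
        rw [zpow_mul]
        norm_cast
      simp only [Function.comp_apply, Equiv.subRight_apply, Equiv.coe_addRight]
      rw [tripleCoeff_succ (pow_ne_zero _ hq) (norm_pow_lt_one hq1 two_ne_zero), hq2, hq2]
      have e1 : q ^ (2 * ((N : ℤ) + 1 - j)) * q ^ (j ^ 2)
          = q ^ (2 * N + 1) * q ^ ((j - 1) ^ 2) := by
        rw [← zpow_natCast, ← zpow_add₀ hq, ← zpow_add₀ hq]
        congr 1
        push_cast
        ring
      have e2 : q ^ (2 * ((N : ℤ) + 1 + j)) * q ^ (j ^ 2)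
          = q ^ (2 * N + 1) * q ^ ((j + 1) ^ 2) := by
        rw [← zpow_natCast, ← zpow_add₀ hq, ← zpow_add₀ hq]
        congr 1
        push_cast
        ring
      have e3 : x * x ^ (j - 1) = x ^ j := by
        rw [zpow_sub_one₀ hx]
        field_simp
      have e4 : x⁻¹ * x ^ (j + 1) = x ^ j := by
        rw [zpow_add_one₀ hx]
        field_simp
      linear_combination (tripleCoeff (q ^ 2) N (j - 1) * x ^ j) * e1
        + (tripleCoeff (q ^ 2) N (j + 1) * x ^ j) * e2
        - (q ^ (2 * N + 1) * tripleCoeff (q ^ 2) N (j - 1) * q ^ ((j - 1) ^ 2)) * e3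
        - (q ^ (2 * N + 1) * tripleCoeff (q ^ 2) N (j + 1) * q ^ ((j + 1) ^ 2)) * e4
    · field_simp
      ring

lemma tendsto_qPochInv {q L : ℂ} (hL : L ≠ 0) (h : Tendsto (qPoch q) atTop (𝓝 L)) :
    Tendsto (qPochInv q) atTop (𝓝 L⁻¹) := by
  have htoNat : Tendsto Int.toNat atTop atTop := tendsto_atTop.2 fun b => by
    filter_upwards [eventually_ge_atTop (b : ℤ)] with n hn
    omega
  refine ((h.comp htoNat).inv₀ hL).congr' ?_
  filter_upwards [eventually_ge_atTop 0] with n hn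
  simp [qPochInv, hn]

lemma exists_norm_qPochInv_le {q : ℂ} (hq1 : ‖q‖ < 1) : ∃ M, ∀ n, ‖qPochInv q n‖ ≤ M := by
  obtain ⟨L, hL, h⟩ := exists_tendsto_qPoch hq1
  obtain ⟨M, hM⟩ := (h.inv₀ hL).norm.bddAbove_range
  refine ⟨M, fun n => ?_⟩
  have hM' (k : ℕ) : ‖(qPoch q k)⁻¹‖ ≤ M := hM ⟨k, rfl⟩
  rw [qPochInv]
  split_ifs
  · exact hM' _
  · rw [norm_zero]
    exact (norm_nonneg _).trans (hM' 0)

/-- The Jacobi triple product. -/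
theorem tendsto_tripleProduct {x q : ℂ} (hx : x ≠ 0) (hq : q ≠ 0) (hq1 : ‖q‖ < 1) :
    Tendsto (fun N => ∏ n ∈ Finset.range N, ((1 - q ^ (2 * n + 2)) *
      ((1 + x * q ^ (2 * n + 1)) * (1 + x⁻¹ * q ^ (2 * n + 1))))) atTop (𝓝 (thetaSeries x q)) := by
  have hq21 := norm_pow_lt_one hq1 two_ne_zero
  obtain ⟨L, hL, h⟩ := exists_tendsto_qPoch hq21
  obtain ⟨M, hM⟩ := exists_norm_qPochInv_le hq21
  obtain ⟨K, hK⟩ := h.norm.bddAbove_range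
  have hK' (k : ℕ) : ‖qPoch (q ^ 2) k‖ ≤ K := hK ⟨k, rfl⟩
  have hlim : Tendsto (fun N : ℕ => ∑' j : ℤ, tripleCoeff (q ^ 2) N j * (x ^ j * q ^ (j ^ 2)))
      atTop (𝓝 (∑' j : ℤ, L⁻¹ * (x ^ j * q ^ (j ^ 2)))) := by
    refine tendsto_tsum_of_dominated_convergence
      (bound := fun j : ℤ => K * (M * M) * ‖x ^ j * q ^ (j ^ 2)‖)
      ((summable_thetaSeries hx hq hq1).norm.mul_left _) (fun j => ?_)
      (Eventually.of_forall fun N j => ?_)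
    · refine Tendsto.mul_const _ ?_
      have hcast : Tendsto (fun N : ℕ => (N : ℤ)) atTop atTop := tendsto_natCast_atTop_atTop
      have ha := (tendsto_qPochInv hL h).comp (tendsto_atTop_add_const_right _ j hcast)
      have hb := (tendsto_qPochInv hL h).comp (tendsto_atTop_add_const_right _ (-j) hcast)
      have hc := h.comp (tendsto_id.const_mul_atTop' (two_pos : (0 : ℕ) < 2))
      have := hc.mul (ha.mul hb)
      rwa [mul_inv_cancel_left₀ hL] at this
    · rw [norm_mul, tripleCoeff, norm_mul, norm_mul]
      have hM0 : 0 ≤ M := (norm_nonneg _).trans (hM 0)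
      have hK0 : 0 ≤ K := (norm_nonneg _).trans (hK' 0)
      gcongr
      · exact hK' _
      · exact hM _
      · exact hM _
  have h2 := h.mul (hlim.congr fun N => (hasSum_tripleCoeff hx hq hq1 N).tsum_eq)
  rw [tsum_mul_left, mul_inv_cancel_left₀ hL] at h2
  refine h2.congr fun N => ?_
  simp only [Finset.prod_mul_distrib, qPoch]
  congr 1
  refine Finset.prod_congr rfl fun n _ => ?_
  rw [← pow_mul, mul_add, mul_one]

lemma thetaSeries_ne_zero {x q : ℂ} (hx : x ≠ 0) (hq : q ≠ 0) (hq1 : ‖q‖ < 1)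
    (h : ∀ n : ℕ, 1 + x * q ^ (2 * n + 1) ≠ 0) (h' : ∀ n : ℕ, 1 + x⁻¹ * q ^ (2 * n + 1) ≠ 0) :
    thetaSeries x q ≠ 0 := by
  obtain ⟨A, hA, ha⟩ := exists_tendsto_prod_one_add (u := fun n => -1 * q ^ (2 * n + 2))
    (summable_norm_mul_pow _ hq1 two_ne_zero 2) fun n => by
      simpa [sub_eq_add_neg] using one_sub_pow_ne_zero hq1 (by omega : 2 * n + 2 ≠ 0)
  obtain ⟨B, hB, hb⟩ := exists_tendsto_prod_one_add
    (summable_norm_mul_pow x hq1 two_ne_zero 1) h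
  obtain ⟨C, hC, hc⟩ := exists_tendsto_prod_one_add
    (summable_norm_mul_pow x⁻¹ hq1 two_ne_zero 1) h'
  have hlim := tendsto_tripleProduct hx hq hq1
  simp only [Finset.prod_mul_distrib] at hlim
  simp only [neg_one_mul, ← sub_eq_add_neg] at ha
  rw [tendsto_nhds_unique hlim (ha.mul (hb.mul hc))]
  exact mul_ne_zero hA (mul_ne_zero hB hC)

/-- The Jacobi triple product at `x = ± q ^ a` and base `q ^ (a + b)`. -/
lemma tendsto_tripleProduct_pow {q s : ℂ} (hs : s ^ 2 = 1) (hq : q ≠ 0) (hq1 : ‖q‖ < 1)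
    (a b : ℕ) (hab : a + b ≠ 0) :
    Tendsto (fun N => ∏ n ∈ Finset.range N, ((1 - q ^ (2 * (a + b) * n + 2 * (a + b))) *
      ((1 + s * q ^ (2 * (a + b) * n + (a + b) + a)) * (1 + s * q ^ (2 * (a + b) * n + b)))))
      atTop (𝓝 (thetaSeries (s * q ^ a) (q ^ (a + b)))) := by
  have hs0 : s ≠ 0 := by
    rintro rfl
    simp at hs
  refine (tendsto_tripleProduct (mul_ne_zero hs0 (pow_ne_zero a hq)) (pow_ne_zero (a + b) hq)
    (norm_pow_lt_one hq1 hab)).congr fun N => Finset.prod_congr rfl fun n _ => ?_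
  have hinv : s⁻¹ = s := inv_eq_of_mul_eq_one_left (by rw [← sq, hs])
  rw [mul_inv, hinv]
  have h1 : (q ^ (a + b)) ^ (2 * n + 1) = q ^ a * q ^ (2 * (a + b) * n + b) := by
    rw [← pow_mul, ← pow_add]
    congr 1
    ring
  congr 1
  · ring
  · congr 1
    · ring
    · rw [h1, mul_assoc, inv_mul_cancel_left₀ (pow_ne_zero a hq)]

lemma prod_range_two_mul (f : ℕ → ℂ) (N : ℕ) :
    ∏ n ∈ Finset.range (2 * N), f n = ∏ n ∈ Finset.range N, (f (2 * n) * f (2 * n + 1)) := by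
  induction N with
  | zero => simp
  | succ N ih =>
    rw [mul_add, mul_one, Finset.prod_range_succ, Finset.prod_range_succ, ih,
      Finset.prod_range_succ, mul_assoc]

/-- In Ramanujan's notation, `ψ(-q) φ(q) = ψ(q) φ(-q²)`. -/
lemma thetaSeries_psi_phi {q : ℂ} (hq : q ≠ 0) (hq1 : ‖q‖ < 1) :
    thetaSeries (-q) (q ^ 2) * thetaSeries 1 q
      = thetaSeries q (q ^ 2) * thetaSeries (-1) (q ^ 2) := by
  have hdouble : Tendsto (fun N : ℕ => 2 * N) atTop atTop :=
    tendsto_id.const_mul_atTop' (two_pos : (0 : ℕ) < 2)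
  have h1 := tendsto_tripleProduct_pow (s := -1) (by norm_num) hq hq1 1 1 (by norm_num)
  have h2 := (tendsto_tripleProduct_pow (s := 1) (by norm_num) hq hq1 0 1 (by norm_num)).comp
    hdouble
  have h3 := tendsto_tripleProduct_pow (s := 1) (by norm_num) hq hq1 1 1 (by norm_num)
  have h4 := tendsto_tripleProduct_pow (s := -1) (by norm_num) hq hq1 0 2 (by norm_num)
  obtain ⟨L, hL, h5⟩ := exists_tendsto_prod_one_add (u := fun n => -1 * q ^ (4 * n + 2))
    (summable_norm_mul_pow _ hq1 four_ne_zero 2) fun n => by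
      simpa [sub_eq_add_neg] using one_sub_pow_ne_zero hq1 (by omega : 4 * n + 2 ≠ 0)
  have h6 := h5.comp hdouble
  have := tendsto_nhds_unique ((h1.mul h2).mul h5) (((h3.mul h4).mul h6).congr fun N => by
    simp only [Function.comp_apply, prod_range_two_mul, ← Finset.prod_mul_distrib]
    refine Finset.prod_congr rfl fun n _ => ?_
    ring)
  simpa using mul_right_cancel₀ hL this

/-- The parametrization of `v²` by theta series, with `v² = q f(-q,-q⁷)² / f(-q³,-q⁵)²`. -/
lemma thetaSeries_v_sq {q : ℂ} (hq : q ≠ 0) (hq1 : ‖q‖ < 1) :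
    q * thetaSeries (-q ^ 3) (q ^ 4) ^ 2 * (thetaSeries 1 q + thetaSeries 1 (q ^ 2))
      = thetaSeries (-q) (q ^ 4) ^ 2 * (thetaSeries 1 q - thetaSeries 1 (q ^ 2)) := by
  have hp (k : ℕ) : q ^ k ≠ 0 := pow_ne_zero k hq
  have hA := thetaSeries_sq (neg_ne_zero.2 hq) (hp 4) (norm_pow_lt_one hq1 four_ne_zero)
  have hB := thetaSeries_sq (neg_ne_zero.2 (hp 3)) (hp 4) (norm_pow_lt_one hq1 four_ne_zero)
  have hq21 := norm_pow_lt_one hq1 two_ne_zero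
  have hψ := thetaSeries_dissection hq (hp 2) hq21
  have hψ' := thetaSeries_dissection (neg_ne_zero.2 hq) (hp 2) hq21
  have hφ := thetaSeries_dissection one_ne_zero (hp 2) hq21
  have hφ' := thetaSeries_dissection (neg_ne_zero.2 one_ne_zero) (hp 2) hq21
  have hb := thetaSeries_mul_sq (inv_ne_zero (hp 6)) (hp 8)
  have ha := thetaSeries_mul_sq (inv_ne_zero (hp 2)) (hp 8)
  rw [thetaSeries_inv, show (q ^ 6)⁻¹ * (q ^ 8) ^ 2 = q ^ 10 by field_simp,
    show (q ^ 6)⁻¹ * q ^ 8 = q ^ 2 by field_simp] at hb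
  rw [thetaSeries_inv, show (q ^ 2)⁻¹ * (q ^ 8) ^ 2 = q ^ 14 by field_simp,
    show (q ^ 2)⁻¹ * q ^ 8 = q ^ 6 by field_simp] at ha
  have hprod := thetaSeries_psi_phi hq hq1
  simp only [neg_sq, ← pow_mul, ← pow_add, one_pow, one_mul, Nat.reduceMul, Nat.reduceAdd]
    at hA hB hψ hψ' hφ hφ'
  have hsum : thetaSeries (-q) (q ^ 4) ^ 2 + q * thetaSeries (-q ^ 3) (q ^ 4) ^ 2
      = thetaSeries q (q ^ 2) * thetaSeries (-1) (q ^ 2) := by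
    rw [hA, hB, hψ, hφ', ← ha, ← hb]
    ring
  have hdiff : thetaSeries (-q) (q ^ 4) ^ 2 - q * thetaSeries (-q ^ 3) (q ^ 4) ^ 2
      = thetaSeries (-q) (q ^ 2) * thetaSeries 1 (q ^ 2) := by
    rw [hA, hB, hψ', hφ, ← ha, ← hb]
    ring
  linear_combination (-thetaSeries 1 q) * hdiff + thetaSeries 1 (q ^ 2) * hsum
    - thetaSeries 1 (q ^ 2) * hprod

lemma summable_norm_chi8_factor_sub_one {q : ℂ} (hq1 : ‖q‖ < 1) :
    Summable fun n : ℕ => ‖(1 - q ^ (n + 1)) ^ chi8 (n + 1) - 1‖ := by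
  have hpos : 0 < 1 - ‖q‖ := by linarith
  have hsum := (summable_norm_mul_pow 1 hq1 one_ne_zero 1).mul_left (1 / (1 - ‖q‖))
  refine Summable.of_nonneg_of_le (fun _ => norm_nonneg _) (fun n => ?_) hsum
  have hle : ‖q ^ (n + 1)‖ ≤ ‖q‖ := by
    rw [norm_pow]
    exact pow_le_of_le_one (norm_nonneg _) hq1.le n.succ_ne_zero
  have hone : 1 ≤ 1 / (1 - ‖q‖) := by
    rw [le_div_iff₀ hpos]
    linarith [norm_nonneg q]
  have hne := one_sub_pow_ne_zero hq1 n.succ_ne_zero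
  rw [one_mul, one_mul]
  unfold chi8
  split_ifs
  · rw [zpow_one, sub_sub_cancel_left, norm_neg]
    exact le_mul_of_one_le_left (norm_nonneg _) hone
  · have h1 : (1 - q ^ (n + 1)) ^ (-1 : ℤ) - 1 = q ^ (n + 1) / (1 - q ^ (n + 1)) := by
      rw [zpow_neg_one]
      field_simp
      ring
    rw [h1, norm_div, div_eq_inv_mul, ← one_div]
    gcongr
    calc 1 - ‖q‖ ≤ ‖(1 : ℂ)‖ - ‖q ^ (n + 1)‖ := by
          rw [norm_one]
          linarith
      _ ≤ ‖1 - q ^ (n + 1)‖ := norm_sub_norm_le _ _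
  · rw [zpow_zero, sub_self, norm_zero]
    positivity

lemma chi8_eight_mul_add (n k : ℕ) : chi8 (8 * n + k) = chi8 k := by
  simp [chi8]

lemma prod_range_eight_mul_chi8 {q : ℂ} (hq1 : ‖q‖ < 1) (N : ℕ) :
    (∏ n ∈ Finset.range (8 * N), (1 - q ^ (n + 1)) ^ chi8 (n + 1))
        * ∏ n ∈ Finset.range N, ((1 - q ^ (8 * n + 5)) * (1 - q ^ (8 * n + 3)))
      = ∏ n ∈ Finset.range N, ((1 - q ^ (8 * n + 7)) * (1 - q ^ (8 * n + 1))) := by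
  induction N with
  | zero => simp
  | succ N ih =>
    have h3 := one_sub_pow_ne_zero hq1 (by omega : 8 * N + 3 ≠ 0)
    have h5 := one_sub_pow_ne_zero hq1 (by omega : 8 * N + 5 ≠ 0)
    rw [mul_add, mul_one]
    simp only [Finset.prod_range_succ, add_assoc, Nat.reduceAdd, chi8_eight_mul_add, ← ih]
    simp only [chi8]
    norm_num
    field_simp

/-- The infinite product in `v` as a quotient of theta series. -/
lemma tprod_chi8_mul_thetaSeries {q : ℂ} (hq : q ≠ 0) (hq1 : ‖q‖ < 1) :
    (∏' n : ℕ, (1 - q ^ (n + 1)) ^ chi8 (n + 1)) * thetaSeries (-q) (q ^ 4)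
      = thetaSeries (-q ^ 3) (q ^ 4) := by
  have hmul := multipliable_one_add_of_summable (summable_norm_chi8_factor_sub_one hq1)
  simp only [add_sub_cancel] at hmul
  have h1 := hmul.hasProd.tendsto_prod_nat.comp
    (tendsto_id.const_mul_atTop' (by norm_num : (0 : ℕ) < 8))
  have h2 := tendsto_tripleProduct_pow (s := -1) (by norm_num) hq hq1 1 3 (by norm_num)
  have h3 := tendsto_tripleProduct_pow (s := -1) (by norm_num) hq hq1 3 1 (by norm_num)
  simp only [neg_one_mul, pow_one, Nat.reduceAdd, Nat.reduceMul] at h2 h3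
  refine tendsto_nhds_unique (h1.mul h2) (h3.congr fun N => ?_)
  have h := prod_range_eight_mul_chi8 hq1 N
  rw [Finset.prod_mul_distrib, Finset.prod_mul_distrib (f := fun n => 1 - q ^ (8 * n + 8))]
  simp only [add_assoc, Nat.reduceAdd, ← sub_eq_add_neg, Function.comp_apply, id_eq]
  linear_combination (-∏ n ∈ Finset.range N, (1 - q ^ (8 * n + 8))) * h

lemma qpow_one_norm_lt_one {τ : ℂ} (hτ : 0 < τ.im) : ‖qpow τ 1‖ < 1 := by
  rw [qpow, Complex.norm_exp, Real.exp_lt_one_iff]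
  simp
  have := Real.pi_pos
  positivity

lemma qpow_natCast (τ : ℂ) (n : ℕ) : qpow τ n = qpow τ 1 ^ n := by
  rw [qpow, qpow, ← Complex.exp_nat_mul]
  congr 1
  push_cast
  ring

lemma thetaSeries_one_qpow (τ : ℂ) (n : ℕ) :
    thetaSeries 1 (qpow τ 1 ^ n) = jacobiTheta (2 * n * τ) := by
  rw [← qpow_natCast]
  refine tsum_congr fun m => ?_
  rw [qpow, one_zpow, one_mul, ← Complex.exp_int_mul]
  congr 1
  push_cast
  ring

lemma jacobiTheta_two_mul_ne_zero {τ : ℂ} (hτ : 0 < τ.im) : jacobiTheta (2 * τ) ≠ 0 := by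
  have h := thetaSeries_one_qpow τ 1
  rw [pow_one, Nat.cast_one, mul_one] at h
  rw [← h]
  have hq1 := qpow_one_norm_lt_one hτ
  have key (n : ℕ) : 1 + qpow τ 1 ^ (2 * n + 1) ≠ 0 := by
    intro h0
    have h1 := norm_pow_lt_one hq1 (2 * n).succ_ne_zero
    rw [Nat.succ_eq_add_one, eq_neg_of_add_eq_zero_right h0, norm_neg, norm_one] at h1
    exact lt_irrefl _ h1
  exact thetaSeries_ne_zero one_ne_zero (Complex.exp_ne_zero _) hq1
    (by simpa using key) (by simpa using key)

/-- `v(τ)²` as a Möbius transform of the quotient `θ(4τ) / θ(2τ)`. -/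
lemma vRam_sq_mul_jacobiTheta {τ : ℂ} (hτ : 0 < τ.im) :
    vRam τ ^ 2 * (jacobiTheta (2 * τ) + jacobiTheta (4 * τ))
      = jacobiTheta (2 * τ) - jacobiTheta (4 * τ) := by
  have hq : qpow τ 1 ≠ 0 := Complex.exp_ne_zero _
  have hq1 := qpow_one_norm_lt_one hτ
  have h1 := thetaSeries_one_qpow τ 1
  have h2 := thetaSeries_one_qpow τ 2
  rw [pow_one, Nat.cast_one, mul_one] at h1
  rw [Nat.cast_two, show (2 : ℂ) * 2 = 4 by norm_num] at h2
  have hv := thetaSeries_v_sq hq hq1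
  have hV := tprod_chi8_mul_thetaSeries hq hq1
  have hne : thetaSeries (-qpow τ 1) (qpow τ 1 ^ 4) ≠ 0 := by
    refine thetaSeries_ne_zero (neg_ne_zero.2 hq) (pow_ne_zero 4 hq)
      (norm_pow_lt_one hq1 four_ne_zero) (fun n => ?_) (fun n => ?_)
    · convert! one_sub_pow_ne_zero hq1 (by omega : 8 * n + 5 ≠ 0) using 1
      ring
    · convert! one_sub_pow_ne_zero hq1 (by omega : 8 * n + 3 ≠ 0) using 1
      field_simp
      ring
  have hhalf : qpow τ (1 / 2) ^ 2 = qpow τ 1 := by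
    rw [qpow, qpow, ← Complex.exp_nat_mul]
    congr 1
    push_cast
    ring
  have hvRam : vRam τ ^ 2
      = qpow τ 1 * (∏' n : ℕ, (1 - qpow τ 1 ^ (n + 1)) ^ chi8 (n + 1)) ^ 2 := by
    rw [vRam, mul_pow, hhalf]
    congr 3
    funext n
    rw [← qpow_natCast]
    norm_cast
  rw [h1, h2, ← hV] at hv
  refine mul_left_cancel₀ (pow_ne_zero 2 hne) ?_
  rw [hvRam]
  linear_combination hv

lemma jacobiTheta_neg_one_div {τ : ℂ} (hτ : 0 < τ.im) :
    jacobiTheta (-1 / τ) = (-Complex.I * τ) ^ (1 / 2 : ℂ) * jacobiTheta τ := by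
  have h := jacobiTheta₂_functional_equation 0 τ
  have hτ0 : τ ≠ 0 := by
    rintro rfl
    simp at hτ
  have hne : (-Complex.I * τ) ^ (1 / 2 : ℂ) ≠ 0 := by
    rw [Ne, Complex.cpow_eq_zero_iff]
    simp [hτ0]
  rw [jacobiTheta_eq_jacobiTheta₂, jacobiTheta_eq_jacobiTheta₂, h]
  simp only [zero_div, ne_eq, OfNat.ofNat_ne_zero, not_false_eq_true, zero_pow, mul_zero,
    Complex.exp_zero, mul_one]
  rw [one_div ((-Complex.I * τ) ^ (1 / 2 : ℂ)), mul_inv_cancel_left₀ hne]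

lemma two_mul_cpow_half {z : ℂ} (hz : z ≠ 0) :
    (2 * z) ^ (1 / 2 : ℂ) = (Real.sqrt 2 : ℂ) * z ^ (1 / 2 : ℂ) := by
  have h := Complex.log_ofReal_mul two_pos hz
  rw [Complex.ofReal_ofNat] at h
  rw [Complex.cpow_def_of_ne_zero (mul_ne_zero two_ne_zero hz), h, add_mul, Complex.exp_add,
    Complex.cpow_def_of_ne_zero hz, Real.sqrt_eq_rpow, Real.rpow_def_of_pos two_pos]
  push_cast
  rfl

/-- If `τ` lies in the upper half-plane and `σ = -1 + √2`, then
`(σ²·v(τ)² - 1)·v(-1/(8τ))² = v(τ)² - σ²`. -/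
theorem v_sq_inversion (τ : ℂ) (hτ : 0 < τ.im) (σ : ℂ) (hσ : σ = -1 + (Real.sqrt 2 : ℂ)) :
    (σ ^ 2 * vRam τ ^ 2 - 1) * vRam (-1 / (8 * τ)) ^ 2 = vRam τ ^ 2 - σ ^ 2 := by
  have hτ0 : τ ≠ 0 := by
    rintro rfl
    simp at hτ
  have hτ' : 0 < (-1 / (8 * τ)).im := by
    have hn : 0 < Complex.normSq τ := Complex.normSq_pos.2 hτ0
    rw [neg_div, Complex.neg_im, one_div, Complex.inv_im, neg_div, neg_neg]
    simp only [Complex.normSq_mul, Complex.mul_im, Complex.re_ofNat, Complex.im_ofNat, zero_mul,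
      add_zero]
    have h8 : 0 < Complex.normSq 8 := Complex.normSq_pos.2 (by norm_num)
    positivity
  have im_pos (r : ℝ) (hr : 0 < r) : 0 < ((r : ℂ) * τ).im := by
    rw [Complex.im_ofReal_mul]
    positivity
  have h2 := jacobiTheta_neg_one_div (by simpa using im_pos 2 two_pos : 0 < (2 * τ).im)
  have h4 := jacobiTheta_neg_one_div (by simpa using im_pos 4 four_pos : 0 < (4 * τ).im)
  rw [show -Complex.I * (4 * τ) = 2 * (-Complex.I * (2 * τ)) by ring,
    two_mul_cpow_half (by simp [hτ0])] at h4
  have hv := vRam_sq_mul_jacobiTheta hτ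
  have hv' := vRam_sq_mul_jacobiTheta hτ'
  have hne := jacobiTheta_two_mul_ne_zero hτ
  have hne' := jacobiTheta_two_mul_ne_zero hτ'
  rw [show 2 * (-1 / (8 * τ)) = -1 / (4 * τ) by field_simp; norm_num] at hv' hne'
  rw [show 4 * (-1 / (8 * τ)) = -1 / (2 * τ) by field_simp; norm_num] at hv'
  rw [h4] at hne'
  rw [h2, h4] at hv'
  set s := (-Complex.I * (2 * τ)) ^ (1 / 2 : ℂ)
  set A := jacobiTheta (2 * τ)
  set B := jacobiTheta (4 * τ)
  set w := vRam τ ^ 2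
  set w' := vRam (-1 / (8 * τ)) ^ 2
  have hs : s ≠ 0 := fun h => hne' (by rw [h]; ring)
  have hr : (Real.sqrt 2 : ℂ) ^ 2 = 2 := by
    norm_cast
    exact Real.sq_sqrt zero_le_two
  set r := (Real.sqrt 2 : ℂ)
  have hw' : w' * (r * B + A) = r * B - A := mul_left_cancel₀ hs (by linear_combination hv')
  have hsum : A + B ≠ 0 := fun h => hne (by
    rw [h] at hv
    linear_combination (h - hv) / 2)
  have hsum' : r * B + A ≠ 0 := fun h => hne (by
    rw [h] at hw'
    linear_combination (h + hw') / 2)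
  rw [eq_div_of_mul_eq hsum hv, eq_div_of_mul_eq hsum' hw', hσ]
  field_simp
  linear_combination 2 * A * B * (r - 1) * hr
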